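/- arXiv:math/0608191 — 2 statements merged into one kernel-verified Lean document; each statement's English description precedes it below -/
import Mathlib

section
/- Let C be a Hurwitz algebra over a field k of characteristic ≠ 2, S the associated para-Hurwitz algebra and J = H₃(C,*). Then D₀(S) = (der J)_{(1,0)}, D₁(S) = (der J)_{(0,1)}, and D₂(S) = (der J)_{(1,1)}. -/
noncomputable section

variable {k : Type*} [Field k] {C : Type*} [NonAssocRing C] [Module k C]
  [SMulCommClass k C C] [IsScalarTower k C C]

/-- The polar form of the norm of the Hurwitz algebra `C`. -/
def bp (q : QuadraticForm k C) (x y : C) : k := QuadraticMap.polar q x y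

/-- The standard involution `x ↦ b(x,1)1 - x` of the Hurwitz algebra `C`. -/
def conj (q : QuadraticForm k C) (x : C) : C := bp q x 1 • (1 : C) - x

/-- The para-Hurwitz product `x • y = x̄ ȳ` on `C`. -/
def pmul (q : QuadraticForm k C) (x y : C) : C := conj q x * conj q y

/-- The underlying space of the Jordan algebra `J = H₃(C,*)`, identified with
`k³ ⊕ S ⊕ S ⊕ S` via the diagonal coordinates and the maps `ι₀, ι₁, ι₂`. -/
abbrev Jtype (k C : Type*) := (Fin 3 → k) × (Fin 3 → C)

/-- The diagonal idempotents `e₀, e₁, e₂` of `J = H₃(C,*)`. -/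
def ee (i : Fin 3) : Jtype k C := (Pi.single i 1, 0)

/-- The elements `ι_i(a)` of `J = H₃(C,*)`. -/
def iot (i : Fin 3) (a : C) : Jtype k C := (0, Pi.single i a)

/-- The Jordan product `x ∘ y = ½(xy + yx)` of `J = H₃(C,*)`, written in the
coordinates `J = k³ ⊕ S ⊕ S ⊕ S` (indices mod 3):
`e_j ∘ e_j = e_j`, `e_j ∘ e_l = 0` for `j ≠ l`, `e_i ∘ ι_i(a) = 0`,
`e_{i+1} ∘ ι_i(a) = e_{i+2} ∘ ι_i(a) = ½ ι_i(a)`,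
`ι_i(a) ∘ ι_{i+1}(b) = ι_{i+2}(a • b)`, and
`ι_i(a) ∘ ι_i(b) = 2 b(a,b) (e_{i+1} + e_{i+2})`. -/
def jmul (q : QuadraticForm k C) (x y : Jtype k C) : Jtype k C :=
  (fun j => x.1 j * y.1 j + 2 * bp q (x.2 (j+1)) (y.2 (j+1))
      + 2 * bp q (x.2 (j+2)) (y.2 (j+2)),
   fun i => ((2:k)⁻¹ * (x.1 (i+1) + x.1 (i+2))) • y.2 i
      + ((2:k)⁻¹ * (y.1 (i+1) + y.1 (i+2))) • x.2 i
      + pmul q (x.2 (i+1)) (y.2 (i+2)) + pmul q (y.2 (i+1)) (x.2 (i+2)))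

/-- Derivations of the Jordan algebra `J = H₃(C,*)`. -/
def IsDerivJ (q : QuadraticForm k C) (f : Jtype k C → Jtype k C) : Prop :=
  ∀ x y, f (jmul q x y) = jmul q (f x) y + jmul q x (f y)

/-- The submodule of `Fin 3 → C` of elements supported at the single index `i`. -/
def piComp (k C : Type*) [Field k] [AddCommGroup C] [Module k C] (i : Fin 3) :
    Submodule k (Fin 3 → C) where
  carrier := {a | ∀ j, j ≠ i → a j = 0}
  add_mem' := by
    intro a b ha hb j hj
    simp [ha j hj, hb j hj]
  zero_mem' := by intro j hj; rfl
  smul_mem' := by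
    intro c a ha j hj
    simp [ha j hj]

/-- The `ℤ₂ × ℤ₂`-grading of `J = H₃(C,*)`:
`J_{(0,0)} = k³`, `J_{(1,0)} = ι₀(S)`, `J_{(0,1)} = ι₁(S)`, `J_{(1,1)} = ι₂(S)`. -/
def Jgrade (k C : Type*) [Field k] [AddCommGroup C] [Module k C] :
    ZMod 2 × ZMod 2 → Submodule k (Jtype k C) := fun p =>
  if p = (0,0) then (⊤ : Submodule k (Fin 3 → k)).prod (⊥ : Submodule k (Fin 3 → C))
  else if p = (1,0) then (⊥ : Submodule k (Fin 3 → k)).prod (piComp k C 0)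
  else if p = (0,1) then (⊥ : Submodule k (Fin 3 → k)).prod (piComp k C 1)
  else (⊥ : Submodule k (Fin 3 → k)).prod (piComp k C 2)

end

noncomputable section

variable {k : Type*} [Field k] {C : Type*} [NonAssocRing C] [Module k C]
  [SMulCommClass k C C] [IsScalarTower k C C]

/-- `L_x`, the multiplication operator `y ↦ x ∘ y` on `J`. -/
def Lmul (q : QuadraticForm k C) (x : Jtype k C) : Jtype k C → Jtype k C :=
  fun y => jmul q x y

/-- The commutator of two maps `J → J`. -/
def brkt (f g : Jtype k C → Jtype k C) : Jtype k C → Jtype k C :=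
  fun y => f (g y) - g (f y)

/-- The inner derivation `D_i(a) = 2[L_{ι_i(a)}, L_{e_{i+1}}]` of `J`. -/
def Dfun (q : QuadraticForm k C) (i : Fin 3) (a : C) : Jtype k C → Jtype k C :=
  fun y => (2:k) • brkt (Lmul q (iot i a)) (Lmul q (ee (i+1))) y

/-- The degree of `ι_i(S)` in the `ℤ₂ × ℤ₂`-grading of `J`. -/
def gidx : Fin 3 → ZMod 2 × ZMod 2 := ![(1,0), (0,1), (1,1)]

end

section Hurwitz

variable {k : Type*} [Field k] {C : Type*} [NonAssocRing C] [Module k C]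
  {q : QuadraticForm k C}

lemma bp_add_left (x y z : C) : bp q (x + y) z = bp q x z + bp q y z :=
  QuadraticMap.polar_add_left q x y z

lemma bp_add_right (x y z : C) : bp q x (y + z) = bp q x y + bp q x z :=
  QuadraticMap.polar_add_right q x y z

lemma bp_smul_left (r : k) (x y : C) : bp q (r • x) y = r * bp q x y := by
  simp [bp, QuadraticMap.polar_smul_left]

lemma bp_smul_right (r : k) (x y : C) : bp q x (r • y) = r * bp q x y := by
  simp [bp, QuadraticMap.polar_smul_right]

lemma bp_neg_left (x y : C) : bp q (-x) y = -bp q x y :=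
  QuadraticMap.polar_neg_left q x y

lemma bp_neg_right (x y : C) : bp q x (-y) = -bp q x y :=
  QuadraticMap.polar_neg_right q x y

lemma bp_sub_left (x y z : C) : bp q (x - y) z = bp q x z - bp q y z :=
  QuadraticMap.polar_sub_left q x y z

lemma bp_sub_right (x y z : C) : bp q x (y - z) = bp q x y - bp q x z :=
  QuadraticMap.polar_sub_right q x y z

lemma bp_zero_left (x : C) : bp q 0 x = 0 := QuadraticMap.polar_zero_left q x

lemma bp_zero_right (x : C) : bp q x 0 = 0 := QuadraticMap.polar_zero_right q x

lemma bp_comm (x y : C) : bp q x y = bp q y x := QuadraticMap.polar_comm q x y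

lemma conj_add (x y : C) : conj q (x + y) = conj q x + conj q y := by
  simp only [conj, bp_add_left]; module

lemma conj_smul (r : k) (x : C) : conj q (r • x) = r • conj q x := by
  simp only [conj, bp_smul_left]; module

lemma conj_neg (x : C) : conj q (-x) = -conj q x := by
  simp only [conj, bp_neg_left]; module

lemma conj_zero : conj q (0 : C) = 0 := by
  simp [conj, bp_zero_left]

lemma pmul_add_left (x y z : C) : pmul q (x + y) z = pmul q x z + pmul q y z := by
  simp only [pmul, conj_add, add_mul]

lemma pmul_add_right (x y z : C) : pmul q x (y + z) = pmul q x y + pmul q x z := by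
  simp only [pmul, conj_add, mul_add]

lemma pmul_neg_left (x y : C) : pmul q (-x) y = -pmul q x y := by
  simp only [pmul, conj_neg, neg_mul]

lemma pmul_neg_right (x y : C) : pmul q x (-y) = -pmul q x y := by
  simp only [pmul, conj_neg, mul_neg]

lemma pmul_zero_left (x : C) : pmul q 0 x = 0 := by
  simp only [pmul, conj_zero, zero_mul]

lemma pmul_zero_right (x : C) : pmul q x 0 = 0 := by
  simp only [pmul, conj_zero, mul_zero]

lemma pmul_smul_left [IsScalarTower k C C] (r : k) (x y : C) :
    pmul q (r • x) y = r • pmul q x y := by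
  simp only [pmul, conj_smul, smul_mul_assoc]

lemma pmul_smul_right [SMulCommClass k C C] (r : k) (x y : C) :
    pmul q x (r • y) = r • pmul q x y := by
  simp only [pmul, conj_smul, mul_smul_comm]

lemma eq_of_forall_bp_eq (hreg : ∀ x : C, (∀ y, QuadraticMap.polar q x y = 0) → x = 0)
    {x y : C} (h : ∀ z, bp q x z = bp q y z) : x = y :=
  sub_eq_zero.1 (hreg _ fun z => (bp_sub_left x y z).trans (sub_eq_zero.2 (h z)))

section Composition

lemma bp_mul_mul_self (hcomp : ∀ x y : C, q (x * y) = q x * q y)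
    (x y z : C) : bp q (x * y) (x * z) = q x * bp q y z := by
  simp only [bp, QuadraticMap.polar, ← mul_add, hcomp]; ring

lemma bp_mul_mul_add (hcomp : ∀ x y : C, q (x * y) = q x * q y)
    (x y z w : C) :
    bp q (x * y) (z * w) + bp q (z * y) (x * w) = bp q x z * bp q y w := by
  have h := bp_mul_mul_self hcomp (x + z) y w
  simp only [add_mul, bp_add_left, bp_add_right, bp_mul_mul_self hcomp] at h
  have hq : q (x + z) = bp q x z + q x + q z := by simp only [bp, QuadraticMap.polar]; ring
  rw [hq] at h
  linear_combination h

lemma bp_mul_left [IsScalarTower k C C] (hcomp : ∀ x y : C, q (x * y) = q x * q y)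
    (x y z : C) :
    bp q (x * y) z = bp q y (conj q x * z) := by
  have h := bp_mul_mul_add hcomp x y 1 z
  simp only [one_mul] at h
  simp only [conj, sub_mul, smul_mul_assoc, one_mul, bp_sub_right, bp_smul_right]
  linear_combination h

lemma bp_mul_right [SMulCommClass k C C] (hcomp : ∀ x y : C, q (x * y) = q x * q y)
    (x y z : C) :
    bp q (x * y) z = bp q x (z * conj q y) := by
  have h := bp_mul_mul_add hcomp x y z 1
  simp only [mul_one] at h
  simp only [conj, mul_sub, mul_smul_comm, mul_one, bp_sub_right, bp_smul_right]
  linear_combination h - bp_comm (q := q) (z * y) x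

variable [IsScalarTower k C C]

lemma conj_conj (hcomp : ∀ x y : C, q (x * y) = q x * q y)
    (hreg : ∀ x : C, (∀ y, QuadraticMap.polar q x y = 0) → x = 0)
    (x : C) : conj q (conj q x) = x := by
  refine eq_of_forall_bp_eq hreg fun z => ?_
  have h := bp_mul_left hcomp (conj q x) z 1
  rw [mul_one, bp_comm, ← bp_mul_left hcomp, mul_one] at h
  rw [h, bp_comm]

lemma bp_conj_mul (hcomp : ∀ x y : C, q (x * y) = q x * q y)
    (hreg : ∀ x : C, (∀ y, QuadraticMap.polar q x y = 0) → x = 0)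
    (x y z : C) : bp q (conj q x * y) z = bp q y (x * z) := by
  rw [bp_mul_left hcomp, conj_conj hcomp hreg]

lemma conj_mul_mul_add (hcomp : ∀ x y : C, q (x * y) = q x * q y)
    (hreg : ∀ x : C, (∀ y, QuadraticMap.polar q x y = 0) → x = 0)
    (x y z : C) :
    conj q x * (z * y) + conj q z * (x * y) = bp q x z • y := by
  refine eq_of_forall_bp_eq hreg fun w => ?_
  rw [bp_add_left, bp_conj_mul hcomp hreg, bp_conj_mul hcomp hreg, bp_smul_left, add_comm,
    bp_mul_mul_add hcomp]

variable [SMulCommClass k C C]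

lemma bp_mul_conj (hcomp : ∀ x y : C, q (x * y) = q x * q y)
    (hreg : ∀ x : C, (∀ y, QuadraticMap.polar q x y = 0) → x = 0)
    (x y z : C) : bp q (x * conj q y) z = bp q x (z * y) := by
  rw [bp_mul_right hcomp, conj_conj hcomp hreg]

lemma conj_mul_rev (hcomp : ∀ x y : C, q (x * y) = q x * q y)
    (hreg : ∀ x : C, (∀ y, QuadraticMap.polar q x y = 0) → x = 0)
    (x y : C) : conj q (x * y) = conj q y * conj q x := by
  refine eq_of_forall_bp_eq hreg fun z => ?_
  rw [bp_conj_mul hcomp hreg, ← mul_one (conj q (x * y)), bp_conj_mul hcomp hreg, bp_comm,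
    bp_mul_right hcomp, one_mul, bp_mul_left hcomp, ← bp_mul_conj hcomp hreg, conj_conj hcomp hreg,
    bp_comm]

lemma mul_mul_conj_add (hcomp : ∀ x y : C, q (x * y) = q x * q y)
    (hreg : ∀ x : C, (∀ y, QuadraticMap.polar q x y = 0) → x = 0)
    (x y z : C) :
    (y * x) * conj q z + (y * z) * conj q x = bp q x z • y := by
  refine eq_of_forall_bp_eq hreg fun w => ?_
  rw [bp_add_left, bp_mul_conj hcomp hreg, bp_mul_conj hcomp hreg, bp_smul_left,
    bp_comm (y * z), bp_mul_mul_add hcomp, mul_comm]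

/-- The norm of a para-Hurwitz algebra is associative. -/
lemma bp_pmul (hcomp : ∀ x y : C, q (x * y) = q x * q y)
    (hreg : ∀ x : C, (∀ y, QuadraticMap.polar q x y = 0) → x = 0)
    (x y z : C) : bp q (pmul q x y) z = bp q x (pmul q y z) := by
  rw [pmul, pmul, bp_conj_mul hcomp hreg, bp_comm, bp_mul_right hcomp]

lemma pmul_pmul_add (hcomp : ∀ x y : C, q (x * y) = q x * q y)
    (hreg : ∀ x : C, (∀ y, QuadraticMap.polar q x y = 0) → x = 0)
    (x y z : C) :
    pmul q x (pmul q y z) + pmul q z (pmul q y x) = bp q x z • y := by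
  simp only [pmul, conj_mul_rev hcomp hreg, conj_conj hcomp hreg]
  exact conj_mul_mul_add hcomp hreg x y z

lemma pmul_pmul_add' (hcomp : ∀ x y : C, q (x * y) = q x * q y)
    (hreg : ∀ x : C, (∀ y, QuadraticMap.polar q x y = 0) → x = 0)
    (x y z : C) :
    pmul q (pmul q x y) z + pmul q (pmul q z y) x = bp q x z • y := by
  simp only [pmul, conj_mul_rev hcomp hreg, conj_conj hcomp hreg]
  exact mul_mul_conj_add hcomp hreg x y z

end Composition

end Hurwitz

section Derivations

lemma fin_three_add (i : Fin 3) : i + 1 + 1 = i + 2 ∧ i + 1 + 2 = i ∧ i + 2 + 1 = i ∧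
    i + 2 + 2 = i + 1 := by
  revert i; decide

lemma fin_three_ne (i : Fin 3) : i + 1 ≠ i ∧ i + 2 ≠ i ∧ i + 2 ≠ i + 1 ∧ i ≠ i + 1 ∧ i ≠ i + 2 ∧
    i + 1 ≠ i + 2 := by
  revert i; decide

lemma forall_fin_three_iff (i : Fin 3) {p : Fin 3 → Prop} :
    (∀ j, p j) ↔ p i ∧ p (i + 1) ∧ p (i + 2) := by
  refine ⟨fun h => ⟨h _, h _, h _⟩, fun ⟨h₀, h₁, h₂⟩ j => ?_⟩
  have h : ∀ i j : Fin 3, j = i ∨ j = i + 1 ∨ j = i + 2 := by decide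
  rcases h i j with rfl | rfl | rfl <;> assumption

lemma Jtype.ext_iff_index {k C : Type*} (i : Fin 3) {x y : Jtype k C} :
    x = y ↔ (x.1 i = y.1 i ∧ x.1 (i + 1) = y.1 (i + 1) ∧ x.1 (i + 2) = y.1 (i + 2)) ∧
      (x.2 i = y.2 i ∧ x.2 (i + 1) = y.2 (i + 1) ∧ x.2 (i + 2) = y.2 (i + 2)) := by
  rw [Prod.ext_iff, funext_iff, funext_iff, forall_fin_three_iff i, forall_fin_three_iff i]

variable {k : Type*} [Field k] {C : Type*} [NonAssocRing C] [Module k C]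
  {q : QuadraticForm k C}

lemma Jtype.linearMap_ext {f g : Module.End k (Jtype k C)} (he : ∀ j, f (ee j) = g (ee j))
    (hι : ∀ j b, f (iot j b) = g (iot j b)) : f = g := by
  refine LinearMap.prod_ext ?_ ?_
  · refine LinearMap.pi_ext' fun j => LinearMap.ext_ring ?_
    simpa [ee] using he j
  · refine LinearMap.pi_ext' fun j => LinearMap.ext fun b => ?_
    simpa [iot] using hι j b

lemma jmul_comm (x y : Jtype k C) : jmul q x y = jmul q y x := by
  ext j <;> simp only [jmul]
  · rw [bp_comm (x.2 (j + 1)), bp_comm (x.2 (j + 2))]; ring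
  · abel

lemma jmul_sub_right (x y z : Jtype k C) : jmul q x (y - z) = jmul q x y - jmul q x z := by
  ext j
  · simp [jmul, bp_sub_right]; ring
  · simp only [sub_eq_add_neg, jmul, Prod.fst_add, Prod.snd_add, Prod.fst_neg, Prod.snd_neg,
      Pi.add_apply, Pi.neg_apply, pmul_add_left, pmul_add_right, pmul_neg_left, pmul_neg_right]
    module

lemma jmul_sub_left (x y z : Jtype k C) : jmul q (x - y) z = jmul q x z - jmul q y z := by
  simp only [jmul_comm _ z, jmul_sub_right]

lemma jmul_zero_left (x : Jtype k C) : jmul q 0 x = 0 := by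
  simpa using jmul_sub_left (q := q) x x x

lemma jmul_ee (i : Fin 3) (x : Jtype k C) :
    jmul q (ee i) x = (Pi.single i (x.1 i), (2 : k)⁻¹ • (x.2 - Pi.single i (x.2 i))) := by
  obtain ⟨h₁₁, h₁₂, h₂₁, h₂₂⟩ := fin_three_add i
  obtain ⟨n₁, n₂, n₃, n₄, n₅, n₆⟩ := fin_three_ne i
  rw [Jtype.ext_iff_index i]
  simp [jmul, ee, bp_zero_left, pmul_zero_left, pmul_zero_right, *]

lemma jmul_ee_self (i : Fin 3) : jmul q (ee i) (ee i) = (ee i : Jtype k C) := by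
  rw [jmul_ee]; simp [ee]

lemma jmul_ee_ee {i j : Fin 3} (h : i ≠ j) : jmul q (ee i) (ee j) = (0 : Jtype k C) := by
  rw [jmul_ee]; simp [ee, h]

lemma jmul_ee_iot_self (i : Fin 3) (a : C) : jmul q (ee i) (iot i a) = (0 : Jtype k C) := by
  rw [jmul_ee]; simp [iot]

lemma jmul_ee_iot {i j : Fin 3} (h : i ≠ j) (a : C) :
    jmul q (ee i) (iot j a) = ((2 : k)⁻¹ • iot j a : Jtype k C) := by
  rw [jmul_ee]; simp [iot, h]

lemma mem_Jgrade_zero {x : Jtype k C} : x ∈ Jgrade k C 0 ↔ x.2 = 0 := by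
  change x ∈ Jgrade k C (0, 0) ↔ _
  simp [Jgrade, Submodule.mem_prod]

lemma mem_Jgrade_gidx {i : Fin 3} {x : Jtype k C} :
    x ∈ Jgrade k C (gidx i) ↔ x.1 = 0 ∧ ∀ j, j ≠ i → x.2 j = 0 := by
  fin_cases i <;> simp [Jgrade, gidx, Submodule.mem_prod, piComp]

lemma exists_iot_eq_of_mem_Jgrade {i : Fin 3} {x : Jtype k C} (hx : x ∈ Jgrade k C (gidx i)) :
    ∃ a, x = iot i a := by
  obtain ⟨h₁, h₂⟩ := mem_Jgrade_gidx.1 hx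
  refine ⟨x.2 i, Prod.ext h₁ (funext fun j => ?_)⟩
  by_cases hj : j = i
  · subst hj; simp [iot]
  · simp [iot, hj, h₂ j hj]

lemma ee_mem_Jgrade (i : Fin 3) : (ee i : Jtype k C) ∈ Jgrade k C 0 :=
  mem_Jgrade_zero.2 rfl

lemma iot_mem_Jgrade (i : Fin 3) (a : C) : (iot i a : Jtype k C) ∈ Jgrade k C (gidx i) :=
  mem_Jgrade_gidx.2 ⟨rfl, fun j hj => by simp [iot, hj]⟩

lemma snd_eq_zero_of_mem_Jgrade_add {i j : Fin 3} {x : Jtype k C}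
    (hx : x ∈ Jgrade k C (gidx i + gidx j)) : x.2 j = 0 := by
  have h : ∀ i j, gidx i + gidx j = 0 ∨ ∃ l, l ≠ j ∧ gidx i + gidx j = gidx l := by decide
  rcases h i j with h | ⟨l, hl, h⟩
  · rw [h, mem_Jgrade_zero] at hx
    simp [hx]
  · rw [h, mem_Jgrade_gidx] at hx
    exact hx.2 j hl.symm

lemma eq_zero_or_eq_gidx (r : ZMod 2 × ZMod 2) : r = 0 ∨ ∃ i, r = gidx i := by
  revert r; decide

/-- A derivation of nonzero degree which annihilates the diagonal idempotents vanishes. -/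
lemma deriv_eq_zero (hchar : (2 : k) ≠ 0) {i : Fin 3} {f : Module.End k (Jtype k C)}
    (hf : IsDerivJ q f)
    (hdeg : ∀ r, ∀ x ∈ Jgrade k C r, f x ∈ Jgrade k C (gidx i + r))
    (hee : ∀ j, f (ee j) = 0) : f = 0 := by
  have hcomm (j x) : f (jmul q (ee j) x) = jmul q (ee j) (f x) := by
    rw [hf, hee, jmul_zero_left, zero_add]
  refine Jtype.linearMap_ext hee fun j b => ?_
  have h := hcomm j (iot j b)
  rw [jmul_ee_iot_self, map_zero, jmul_ee, eq_comm, Prod.ext_iff] at h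
  obtain ⟨h₁, h₂⟩ := h
  have hj := snd_eq_zero_of_mem_Jgrade_add (hdeg _ _ (iot_mem_Jgrade j b))
  refine Prod.ext (funext fun l => ?_) ?_
  · by_cases hl : l = j
    · subst hl; simpa using congrFun h₁ l
    · have h := congrFun (congrArg Prod.fst (hcomm l (iot j b))) l
      rw [jmul_ee_iot hl, map_smul, jmul_ee] at h
      simp only [Prod.smul_fst, Pi.smul_apply, smul_eq_mul, Pi.single_eq_same] at h
      field_simp at h
      simp only [LinearMap.zero_apply, Prod.fst_zero, Pi.zero_apply]
      linear_combination -h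
  · simpa [hj, hchar] using h₂

section Dfun

variable (q) (i : Fin 3) (a : C)

lemma Dfun_fst (hchar : (2 : k) ≠ 0) (x : Jtype k C) :
    (Dfun q i a x).1 i = 0 ∧ (Dfun q i a x).1 (i + 1) = -(2 * bp q a (x.2 i)) ∧
      (Dfun q i a x).1 (i + 2) = 2 * bp q a (x.2 i) := by
  obtain ⟨h₁₁, h₁₂, h₂₁, h₂₂⟩ := fin_three_add i
  obtain ⟨n₁, n₂, n₃, n₄, n₅, n₆⟩ := fin_three_ne i
  simp only [Dfun, brkt, Lmul, jmul_ee]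
  simp [jmul, iot, bp_zero_left, bp_smul_right, *]
  ring

lemma Dfun_snd (hchar : (2 : k) ≠ 0) [SMulCommClass k C C] [IsScalarTower k C C]
    (x : Jtype k C) :
    (Dfun q i a x).2 i = ((2 : k)⁻¹ * (x.1 (i + 1) - x.1 (i + 2))) • a ∧
      (Dfun q i a x).2 (i + 1) = pmul q (x.2 (i + 2)) a ∧
      (Dfun q i a x).2 (i + 2) = -pmul q a (x.2 (i + 1)) := by
  obtain ⟨h₁₁, h₁₂, h₂₁, h₂₂⟩ := fin_three_add i
  obtain ⟨n₁, n₂, n₃, n₄, n₅, n₆⟩ := fin_three_ne i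
  simp only [Dfun, brkt, Lmul, jmul_ee]
  simp [jmul, iot, pmul_zero_left, pmul_zero_right, pmul_smul_left,
    pmul_smul_right, *]
  match_scalars
  field_simp
  ring

variable [SMulCommClass k C C] [IsScalarTower k C C]

/-- The map `D_i(a)` as a linear endomorphism of `J`. -/
def DLin (hchar : (2 : k) ≠ 0) : Module.End k (Jtype k C) where
  toFun := Dfun q i a
  map_add' x y := by
    rw [Jtype.ext_iff_index i]
    simp only [Prod.fst_add, Prod.snd_add, Pi.add_apply, (Dfun_fst q i a hchar _).2,
      (Dfun_fst q i a hchar _).1, (Dfun_snd q i a hchar _).1, (Dfun_snd q i a hchar _).2,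
      bp_add_right, pmul_add_left, pmul_add_right]
    refine ⟨⟨?_, ?_, ?_⟩, ?_, ?_, ?_⟩ <;> first | trivial | ring1 | module
  map_smul' r x := by
    rw [Jtype.ext_iff_index i]
    simp only [Prod.smul_fst, Prod.smul_snd, Pi.smul_apply, Dfun_fst q i a hchar,
      Dfun_snd q i a hchar, bp_smul_right, pmul_smul_left, pmul_smul_right, RingHom.id_apply,
      smul_eq_mul]
    refine ⟨⟨?_, ?_, ?_⟩, ?_, ?_, ?_⟩ <;> first | trivial | ring1 | module

lemma isDerivJ_Dfun (hchar : (2 : k) ≠ 0) (hcomp : ∀ x y : C, q (x * y) = q x * q y)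
    (hreg : ∀ x : C, (∀ y, QuadraticMap.polar q x y = 0) → x = 0) :
    IsDerivJ q (Dfun q i a) := by
  intro x y
  obtain ⟨h₁₁, h₁₂, h₂₁, h₂₂⟩ := fin_three_add i
  have hs : (2 : k)⁻¹ * 2 = 1 := inv_mul_cancel₀ hchar
  rw [Jtype.ext_iff_index i]
  simp only [Dfun_fst q i a hchar, Dfun_snd q i a hchar, Prod.fst_add, Prod.snd_add, Pi.add_apply]
  simp only [jmul, h₁₁, h₁₂, h₂₁, h₂₂]
  simp only [Dfun_fst q i a hchar, Dfun_snd q i a hchar, bp_add_right, pmul_add_left,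
    pmul_add_right, bp_smul_left, bp_smul_right, pmul_smul_left, pmul_smul_right, bp_neg_left,
    bp_neg_right, pmul_neg_left, pmul_neg_right]
  have B := bp_comm (q := q)
  have A := bp_pmul hcomp hreg
  have P := pmul_pmul_add hcomp hreg
  have P' := pmul_pmul_add' hcomp hreg
  refine ⟨⟨?_, ?_, ?_⟩, ?_, ?_, ?_⟩
  · linear_combination -2 * A (x.2 (i + 2)) a (y.2 (i + 1)) - 2 * A (y.2 (i + 2)) a (x.2 (i + 1)) +
      2 * B (pmul q a (x.2 (i + 1))) (y.2 (i + 2)) - 2 * B (x.2 (i + 1)) (pmul q (y.2 (i + 2)) a)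
  · linear_combination (-2 * x.1 (i + 1) * bp q a (y.2 i) - 2 * y.1 (i + 1) * bp q a (x.2 i)) * hs -
      2 * 2⁻¹ * (y.1 (i + 1) - y.1 (i + 2)) * B (x.2 i) a + 2 * A a (x.2 (i + 1)) (y.2 (i + 2)) +
      2 * A a (y.2 (i + 1)) (x.2 (i + 2)) + 2 * B (x.2 (i + 2)) (pmul q a (y.2 (i + 1)))
  · linear_combination (2 * x.1 (i + 2) * bp q a (y.2 i) + 2 * y.1 (i + 2) * bp q a (x.2 i)) * hs -
      2 * 2⁻¹ * (y.1 (i + 1) - y.1 (i + 2)) * B (x.2 i) a +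
      2 * B a (pmul q (x.2 (i + 1)) (y.2 (i + 2))) + 2 * A (x.2 (i + 1)) (y.2 (i + 2)) a +
      2 * B a (pmul q (y.2 (i + 1)) (x.2 (i + 2))) + 2 * A (y.2 (i + 1)) (x.2 (i + 2)) a -
      2 * B (pmul q (x.2 (i + 2)) a) (y.2 (i + 1))
  · linear_combination (norm := (match_scalars <;> field_simp <;> ring))
      P (x.2 (i + 1)) a (y.2 (i + 1)) - P' (x.2 (i + 2)) a (y.2 (i + 2))
  · linear_combination (norm := (match_scalars <;> field_simp <;> ring))
      P' a (y.2 (i + 1)) (x.2 i) + P' a (x.2 (i + 1)) (y.2 i)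
  · linear_combination (norm := (match_scalars <;> field_simp <;> ring))
      -P a (x.2 (i + 2)) (y.2 i) - P a (y.2 (i + 2)) (x.2 i)

lemma Dfun_mem_Jgrade (hchar : (2 : k) ≠ 0) (r : ZMod 2 × ZMod 2) (x : Jtype k C)
    (hx : x ∈ Jgrade k C r) : Dfun q i a x ∈ Jgrade k C (gidx i + r) := by
  obtain ⟨h₁₁, h₁₂, h₂₁, h₂₂⟩ := fin_three_add i
  obtain ⟨n₁, n₂, n₃, n₄, n₅, n₆⟩ := fin_three_ne i
  obtain ⟨f₀, f₁, f₂⟩ := Dfun_fst q i a hchar x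
  obtain ⟨s₀, s₁, s₂⟩ := Dfun_snd q i a hchar x
  have hadd : ∀ i, gidx i + gidx i = 0 ∧ gidx i + gidx (i + 1) = gidx (i + 2) ∧
      gidx i + gidx (i + 2) = gidx (i + 1) := by decide
  rcases eq_zero_or_eq_gidx r with rfl | ⟨j, rfl⟩
  · rw [mem_Jgrade_zero] at hx
    rw [add_zero, mem_Jgrade_gidx, funext_iff, forall_fin_three_iff i, forall_fin_three_iff i]
    simp_all [bp_zero_right, pmul_zero_left, pmul_zero_right]
  · revert j
    rw [forall_fin_three_iff i]
    simp only [(hadd i).1, (hadd i).2, mem_Jgrade_gidx, mem_Jgrade_zero, funext_iff,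
      forall_fin_three_iff i]
    refine ⟨?_, ?_, ?_⟩ <;> intro hx <;>
    simp_all [bp_zero_right, pmul_zero_left, pmul_zero_right]

lemma Dfun_ee (hchar : (2 : k) ≠ 0) : Dfun q i a (ee i) = 0 ∧
    Dfun q i a (ee (i + 1)) = iot i ((2 : k)⁻¹ • a) ∧
    Dfun q i a (ee (i + 2)) = -iot i ((2 : k)⁻¹ • a) := by
  obtain ⟨n₁, n₂, n₃, n₄, n₅, n₆⟩ := fin_three_ne i
  simp only [Jtype.ext_iff_index i]
  simp [Dfun_fst q i a hchar, Dfun_snd q i a hchar, ee, iot, bp_zero_right, pmul_zero_left,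
    pmul_zero_right, *]

end Dfun

lemma IsDerivJ.sub {f g : Module.End k (Jtype k C)} (hf : IsDerivJ q f) (hg : IsDerivJ q g) :
    IsDerivJ q ⇑(f - g) := by
  intro x y
  simp only [LinearMap.sub_apply, hf x y, hg x y, jmul_sub_left, jmul_sub_right]
  abel

lemma exists_deriv_ee (hchar : (2 : k) ≠ 0) {i : Fin 3} {f : Module.End k (Jtype k C)}
    (hf : IsDerivJ q f)
    (hdeg : ∀ r, ∀ x ∈ Jgrade k C r, f x ∈ Jgrade k C (gidx i + r)) :
    ∃ c, f (ee i) = 0 ∧ f (ee (i + 1)) = iot i c ∧ f (ee (i + 2)) = -iot i c := by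
  obtain ⟨n₁, n₂, n₃, n₄, n₅, n₆⟩ := fin_three_ne i
  have hex (j) : ∃ c, f (ee j) = iot i c := by
    have h := hdeg _ _ (ee_mem_Jgrade j)
    rw [add_zero] at h
    exact exists_iot_eq_of_mem_Jgrade h
  obtain ⟨c₀, h₀⟩ := hex i
  obtain ⟨c₁, h₁⟩ := hex (i + 1)
  obtain ⟨c₂, h₂⟩ := hex (i + 2)
  refine ⟨c₁, ?_, h₁, ?_⟩
  · rw [← jmul_ee_self (q := q) i, hf, jmul_comm, h₀, jmul_ee_iot_self, add_zero]
  · have h := hf (ee (i + 1)) (ee (i + 2))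
    rw [jmul_ee_ee n₆, map_zero, h₁, h₂, jmul_comm, jmul_ee_iot n₂, jmul_ee_iot n₁, ← smul_add,
      eq_comm, smul_eq_zero_iff_right (inv_ne_zero hchar)] at h
    rw [h₂]
    exact eq_neg_of_add_eq_zero_right h

end Derivations

/-- `D₀(S) = (der J)_{(1,0)}`, `D₁(S) = (der J)_{(0,1)}` and
`D₂(S) = (der J)_{(1,1)}`: for each `i`, the set of maps `D_i(a)` (`a ∈ S`) coincides
with the set of (linear) derivations of `J` of degree `gidx i`. -/
theorem stmt_8 {k : Type*} [Field k] {C : Type*} [NonAssocRing C] [Module k C]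
    [SMulCommClass k C C] [IsScalarTower k C C]
    (hchar : (2 : k) ≠ 0)
    (q : QuadraticForm k C)
    (hcomp : ∀ x y : C, q (x * y) = q x * q y)
    (hreg : ∀ x : C, (∀ y, QuadraticMap.polar q x y = 0) → x = 0) :
    ∀ i : Fin 3,
      {f : Jtype k C → Jtype k C | ∃ a : C, f = Dfun q i a} =
      {f : Jtype k C → Jtype k C | ∃ d : Module.End k (Jtype k C), ⇑d = f ∧
        IsDerivJ q ⇑d ∧
        ∀ rs : ZMod 2 × ZMod 2, ∀ x ∈ Jgrade k C rs, d x ∈ Jgrade k C (gidx i + rs)} := by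
  intro i
  ext f
  simp only [Set.mem_ofPred_eq]
  constructor
  · rintro ⟨a, rfl⟩
    exact ⟨DLin q i a hchar, rfl, isDerivJ_Dfun q i a hchar hcomp hreg,
      Dfun_mem_Jgrade q i a hchar⟩
  · rintro ⟨d, rfl, hd, hdeg⟩
    obtain ⟨c, h₀, h₁, h₂⟩ := exists_deriv_ee hchar hd hdeg
    obtain ⟨e₀, e₁, e₂⟩ := Dfun_ee q i ((2 : k) • c) hchar
    rw [inv_smul_smul₀ hchar] at e₁ e₂
    refine ⟨(2 : k) • c, ?_⟩
    have h := deriv_eq_zero hchar (f := d - DLin q i ((2 : k) • c) hchar)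
      (hd.sub (isDerivJ_Dfun q i _ hchar hcomp hreg))
      (fun r x hx => sub_mem (hdeg r x hx) (Dfun_mem_Jgrade q i _ hchar r x hx))
      ((forall_fin_three_iff i).2 ⟨sub_eq_zero.2 (h₀.trans e₀.symm),
        sub_eq_zero.2 (h₁.trans e₁.symm), sub_eq_zero.2 (h₂.trans e₂.symm)⟩)
    exact congrArg DFunLike.coe (sub_eq_zero.1 h)
end

section
/- Let k be a field of characteristic 3 and let J = Mat₃(k) with the Jordan product x ∘ y = ½(xy + yx), J₀ its trace-zero elements, and T_J^o = J₀/k1 as in the context. Then the bilinear form (x̂|ŷ) = t(x ∘ y) and the triple product [x̂ŷẑ] = class of x ∘ (y ∘ z) − y ∘ (x ∘ z) are well defined on T_J^o (they depend only on the classes of x, y, z modulo k1, and x ∘ (y ∘ z) − y ∘ (x ∘ z) ∈ J₀); the form is symmetric and nondegenerate; and with these operations T_J^o is a simple orthogonal triple system. -/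
set_option linter.unusedSectionVars false

noncomputable section

variable (k : Type*) [Field k] [CharP k 3]

/-- The Jordan product `x ∘ y = ½(xy + yx)` on `Mat₃(k)`. -/
def jm (x y : Matrix (Fin 3) (Fin 3) k) : Matrix (Fin 3) (Fin 3) k :=
  (2:k)⁻¹ • (x * y + y * x)

/-- The trace-zero elements `J₀` of `J = Mat₃(k)`. -/
def J0 : Submodule k (Matrix (Fin 3) (Fin 3) k) :=
  LinearMap.ker (Matrix.traceLinearMap (Fin 3) k k)

lemma one_mem_J0 : (1 : Matrix (Fin 3) (Fin 3) k) ∈ J0 k := by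
  have h3 : ((3 : ℕ) : k) = 0 := CharP.cast_eq_zero k 3
  have h3' : (3 : k) = 0 := by exact_mod_cast h3
  simp [J0, Matrix.trace_one, h3']

/-- The line `k1` inside `J₀` (recall `char k = 3`). -/
def K1 : Submodule k (J0 k) :=
  Submodule.span k {(⟨1, one_mem_J0 k⟩ : J0 k)}

/-- The orthogonal triple system `T_J^o = J₀/k1`. -/
abbrev TJo := (J0 k) ⧸ (K1 k)

lemma brkt_mem (x y z : Matrix (Fin 3) (Fin 3) k) :
    jm k x (jm k y z) - jm k y (jm k x z) ∈ J0 k := by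
  have c1 : (y*z*x).trace = (x*y*z).trace := Matrix.trace_mul_cycle y z x
  have c2 : (z*y*x).trace = (x*z*y).trace := Matrix.trace_mul_cycle z y x
  have c3 : (y*x*z).trace = (x*z*y).trace :=
    (Matrix.trace_mul_cycle y x z).trans c2
  have c4 : (z*x*y).trace = (x*y*z).trace :=
    (Matrix.trace_mul_cycle z x y).trans c1
  simp only [J0, LinearMap.mem_ker, Matrix.traceLinearMap_apply, Matrix.trace_sub, jm,
    Matrix.smul_mul, Matrix.mul_smul, mul_add, add_mul, Matrix.trace_smul, Matrix.trace_add,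
    smul_add, smul_eq_mul, ← Matrix.mul_assoc]
  rw [c1, c2, c3, c4]
  ring

end

section CubicIdentities

variable {R : Type*} [CommRing R]

/-- The polarization of the Cayley–Hamilton identity for `3 × 3` matrices. -/
lemma polarized_cayley_hamilton (x y : Matrix (Fin 3) (Fin 3) R) :
    x * y * y + y * x * y + y * y * x - x.trace • (y * y) - y.trace • (x * y + y * x)
      + y.adjugate.trace • x + (x.trace * y.trace - (x * y).trace) • y
      = (y.adjugate * x).trace • 1 := by
  ext i j
  fin_cases i <;> fin_cases j <;>
    simp [Matrix.mul_apply, Matrix.trace, Fin.sum_univ_three, Matrix.adjugate_fin_three,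
      Matrix.vecMul, dotProduct] <;> ring

lemma two_mul_trace_adjugate (y : Matrix (Fin 3) (Fin 3) R) :
    2 * y.adjugate.trace = y.trace ^ 2 - (y * y).trace := by
  simp [Matrix.mul_apply, Matrix.trace, Fin.sum_univ_three, Matrix.adjugate_fin_three]
  ring

end CubicIdentities

section LiftBilinear

variable {R M N : Type*} [CommRing R] [AddCommGroup M] [Module R M] [AddCommGroup N] [Module R N]

/-- Descend a bilinear map that vanishes on `K` in each argument to `M ⧸ K`. -/
noncomputable def liftBilinear (K : Submodule R M) (f : M →ₗ[R] M →ₗ[R] N)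
    (hl : ∀ x ∈ K, ∀ y, f x y = 0) (hr : ∀ x, ∀ y ∈ K, f x y = 0) :
    (M ⧸ K) →ₗ[R] (M ⧸ K) →ₗ[R] N :=
  K.liftQ (K.liftQ f.flip fun y hy => LinearMap.ext fun x => hr x y hy).flip fun x hx =>
    LinearMap.ext fun v => by
      obtain ⟨y, rfl⟩ := Submodule.Quotient.mk_surjective K v
      exact hl x hx y

lemma liftBilinear_mk (K : Submodule R M) (f : M →ₗ[R] M →ₗ[R] N) (hl hr) (x y : M) :
    liftBilinear K f hl hr (Submodule.Quotient.mk x) (Submodule.Quotient.mk y) = f x y :=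
  rfl

end LiftBilinear

section TracelessQuotient

variable (k : Type*) [Field k] [CharP k 3]

attribute [local instance] LieRing.ofAssociativeRing

lemma three_eq_zero_of_charP_three : (3 : k) = 0 := by
  exact_mod_cast CharP.cast_eq_zero k 3

lemma two_ne_zero_of_charP_three : (2 : k) ≠ 0 := by
  intro h
  apply one_ne_zero (α := k)
  linear_combination three_eq_zero_of_charP_three k - h

lemma inv_two_of_charP_three : (2 : k)⁻¹ = -1 := by
  rw [inv_eq_iff_eq_inv, inv_neg_one]
  linear_combination three_eq_zero_of_charP_three k

lemma mem_J0_iff (x : Matrix (Fin 3) (Fin 3) k) : x ∈ J0 k ↔ x.trace = 0 := Iff.rfl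

lemma mem_K1_iff (x : J0 k) :
    x ∈ K1 k ↔ ∃ c : k, (x : Matrix (Fin 3) (Fin 3) k) = c • 1 := by
  rw [K1, Submodule.mem_span_singleton]
  exact ⟨fun ⟨c, hc⟩ => ⟨c, by rw [← hc]; rfl⟩, fun ⟨c, hc⟩ => ⟨c, Subtype.ext hc.symm⟩⟩

lemma trace_jm (x y : Matrix (Fin 3) (Fin 3) k) : (jm k x y).trace = (x * y).trace := by
  rw [jm, Matrix.trace_smul, Matrix.trace_add, Matrix.trace_mul_comm y x, ← two_mul, smul_eq_mul,
    inv_mul_cancel_left₀ (two_ne_zero_of_charP_three k)]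

lemma jm_jm_sub_jm_jm (x y z : Matrix (Fin 3) (Fin 3) k) :
    jm k x (jm k y z) - jm k y (jm k x z) = ⁅⁅x, y⁆, z⁆ := by
  simp only [jm, inv_two_of_charP_three, Ring.lie_def, neg_smul, one_smul]
  noncomm_ring

/-- The form on `J₀ / k1` induced by the trace form. -/
noncomputable def traceFormTJo : TJo k →ₗ[k] TJo k →ₗ[k] k :=
  liftBilinear (K1 k)
    (LinearMap.mk₂ k (fun x y : J0 k => ((x : Matrix (Fin 3) (Fin 3) k) * y).trace)
      (by intros; simp [add_mul]) (by intros; simp) (by intros; simp [mul_add])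
      (by intros; simp))
    (by
      intro x hx y
      obtain ⟨c, hc⟩ := (mem_K1_iff k x).1 hx
      simp [hc, (mem_J0_iff k _).1 y.2])
    (by
      intro x y hy
      obtain ⟨c, hc⟩ := (mem_K1_iff k y).1 hy
      simp [hc, (mem_J0_iff k _).1 x.2])

lemma traceFormTJo_mk (x y : J0 k) :
    traceFormTJo k (Submodule.Quotient.mk x) (Submodule.Quotient.mk y)
      = ((x : Matrix (Fin 3) (Fin 3) k) * y).trace :=
  rfl

lemma lie_mem_J0 (c z : Matrix (Fin 3) (Fin 3) k) : ⁅c, z⁆ ∈ J0 k := by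
  rw [mem_J0_iff, Ring.lie_def, Matrix.trace_sub, Matrix.trace_mul_comm, sub_self]

/-- The inner derivation `ad c` restricted to `J₀`. -/
noncomputable def adJ0 (c : Matrix (Fin 3) (Fin 3) k) : J0 k →ₗ[k] J0 k where
  toFun z := ⟨⁅c, (z : Matrix (Fin 3) (Fin 3) k)⁆, lie_mem_J0 k c z⟩
  map_add' _ _ := Subtype.ext (by simp)
  map_smul' _ _ := Subtype.ext (by simp)

/-- The endomorphism of `J₀ / k1` induced by `ad c`. -/
noncomputable def adTJo (c : Matrix (Fin 3) (Fin 3) k) : TJo k →ₗ[k] TJo k :=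
  (K1 k).mapQ (K1 k) (adJ0 k c) <| by
    intro z hz
    obtain ⟨a, ha⟩ := (mem_K1_iff k z).1 hz
    exact (mem_K1_iff k _).2 ⟨0, by simp [adJ0, ha, Ring.lie_def]⟩

lemma adTJo_mk (c : Matrix (Fin 3) (Fin 3) k) (z : J0 k) :
    adTJo k c (Submodule.Quotient.mk z)
      = Submodule.Quotient.mk ⟨⁅c, (z : Matrix (Fin 3) (Fin 3) k)⁆, lie_mem_J0 k c z⟩ :=
  rfl

lemma adTJo_add (c d : Matrix (Fin 3) (Fin 3) k) : adTJo k (c + d) = adTJo k c + adTJo k d := by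
  refine LinearMap.ext fun v => ?_
  obtain ⟨z, rfl⟩ := Submodule.Quotient.mk_surjective _ v
  rw [LinearMap.add_apply, adTJo_mk, adTJo_mk, adTJo_mk, ← Submodule.Quotient.mk_add]
  exact congrArg _ (Subtype.ext (add_lie c d (z : Matrix (Fin 3) (Fin 3) k)))

lemma adTJo_smul (a : k) (c : Matrix (Fin 3) (Fin 3) k) : adTJo k (a • c) = a • adTJo k c := by
  refine LinearMap.ext fun v => ?_
  obtain ⟨z, rfl⟩ := Submodule.Quotient.mk_surjective _ v
  rw [LinearMap.smul_apply, adTJo_mk, adTJo_mk, ← Submodule.Quotient.mk_smul]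
  exact congrArg _ (Subtype.ext (smul_lie a c (z : Matrix (Fin 3) (Fin 3) k)))

lemma adTJo_zero : adTJo k 0 = 0 := by
  simpa using adTJo_smul k 0 0

/-- The triple product on `J₀ / k1` induced by `⁅⁅x, y⁆, z⁆`. -/
noncomputable def tripleTJo : TJo k →ₗ[k] TJo k →ₗ[k] TJo k →ₗ[k] TJo k :=
  liftBilinear (K1 k)
    (LinearMap.mk₂ k
      (fun x y : J0 k => adTJo k ⁅(x : Matrix (Fin 3) (Fin 3) k), (y : Matrix (Fin 3) (Fin 3) k)⁆)
      (by intros; simp [adTJo_add]) (by intros; simp [adTJo_smul])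
      (by intros; simp [adTJo_add]) (by intros; simp [adTJo_smul]))
    (by
      intro x hx y
      obtain ⟨c, hc⟩ := (mem_K1_iff k x).1 hx
      simp [hc, Ring.lie_def, adTJo_zero])
    (by
      intro x y hy
      obtain ⟨c, hc⟩ := (mem_K1_iff k y).1 hy
      simp [hc, Ring.lie_def, adTJo_zero])

lemma tripleTJo_mk (x y z : J0 k) :
    tripleTJo k (Submodule.Quotient.mk x) (Submodule.Quotient.mk y) (Submodule.Quotient.mk z)
      = Submodule.Quotient.mk
          ⟨⁅⁅(x : Matrix (Fin 3) (Fin 3) k), (y : Matrix (Fin 3) (Fin 3) k)⁆, (z : Matrix _ _ k)⁆,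
            lie_mem_J0 k _ _⟩ :=
  rfl

lemma traceFormTJo_comm (u v : TJo k) : traceFormTJo k u v = traceFormTJo k v u := by
  obtain ⟨x, rfl⟩ := Submodule.Quotient.mk_surjective _ u
  obtain ⟨y, rfl⟩ := Submodule.Quotient.mk_surjective _ v
  rw [traceFormTJo_mk, traceFormTJo_mk, Matrix.trace_mul_comm]

lemma traceFormTJo_nondegenerate (u : TJo k) (h : ∀ v, traceFormTJo k u v = 0) : u = 0 := by
  obtain ⟨⟨x, hx⟩, rfl⟩ := Submodule.Quotient.mk_surjective _ u
  have htr : ∀ y : Matrix (Fin 3) (Fin 3) k, y.trace = 0 → (x * y).trace = 0 :=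
    fun y hy => h (Submodule.Quotient.mk ⟨y, hy⟩)
  have hoff : ∀ i j, i ≠ j → x i j = 0 := fun i j hij => by
    simpa [Matrix.trace_mul_single] using
      htr (Matrix.single j i 1) (Matrix.trace_single_eq_of_ne j i 1 hij.symm)
  have hdiag : ∀ i, x i i = x 0 0 := fun i => by
    have h := htr (Matrix.single i i 1 - Matrix.single 0 0 1) (by simp)
    rw [mul_sub, Matrix.trace_sub, sub_eq_zero] at h
    simpa [Matrix.trace_mul_single] using h
  rw [Submodule.Quotient.mk_eq_zero, mem_K1_iff]
  refine ⟨x 0 0, ?_⟩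
  ext i j
  by_cases hij : i = j
  · subst hij
    simp [hdiag i]
  · simp [hoff i j hij, Matrix.one_apply_ne hij]

lemma tripleTJo_self (u w : TJo k) : tripleTJo k u u w = 0 := by
  obtain ⟨x, rfl⟩ := Submodule.Quotient.mk_surjective _ u
  obtain ⟨z, rfl⟩ := Submodule.Quotient.mk_surjective _ w
  rw [tripleTJo_mk, Submodule.Quotient.mk_eq_zero, mem_K1_iff]
  exact ⟨0, by simp⟩

lemma tripleTJo_apply_right (u w : TJo k) :
    tripleTJo k u w w = traceFormTJo k u w • w - traceFormTJo k w w • u := by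
  obtain ⟨x, rfl⟩ := Submodule.Quotient.mk_surjective _ u
  obtain ⟨y, rfl⟩ := Submodule.Quotient.mk_surjective _ w
  rw [tripleTJo_mk, traceFormTJo_mk, traceFormTJo_mk, ← Submodule.Quotient.mk_smul,
    ← Submodule.Quotient.mk_smul, ← Submodule.Quotient.mk_sub, Submodule.Quotient.eq, mem_K1_iff]
  obtain ⟨x, hx⟩ := x
  obtain ⟨y, hy⟩ := y
  rw [mem_J0_iff] at hx hy
  refine ⟨(y.adjugate * x).trace, ?_⟩
  have h3 := three_eq_zero_of_charP_three k
  have hs : y.adjugate.trace = (y * y).trace := by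
    have h := two_mul_trace_adjugate y
    rw [hy] at h
    linear_combination y.adjugate.trace * h3 - h
  have hch := polarized_cayley_hamilton x y
  rw [hx, hy, hs] at hch
  have h3m : (3 : k) • (y * x * y) = 0 := by rw [h3, zero_smul]
  rw [← hch, ← sub_eq_zero, ← neg_eq_zero, ← h3m]
  simp only [Ring.lie_def, Submodule.coe_sub, Submodule.coe_smul, ofNat_smul_eq_nsmul]
  simp only [zero_smul, sub_zero, zero_mul, zero_sub, neg_smul]
  noncomm_ring

lemma tripleTJo_derivation (a b u v w : TJo k) :
    tripleTJo k a b (tripleTJo k u v w)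
      = tripleTJo k (tripleTJo k a b u) v w + tripleTJo k u (tripleTJo k a b v) w
        + tripleTJo k u v (tripleTJo k a b w) := by
  obtain ⟨a, rfl⟩ := Submodule.Quotient.mk_surjective _ a
  obtain ⟨b, rfl⟩ := Submodule.Quotient.mk_surjective _ b
  obtain ⟨u, rfl⟩ := Submodule.Quotient.mk_surjective _ u
  obtain ⟨v, rfl⟩ := Submodule.Quotient.mk_surjective _ v
  obtain ⟨w, rfl⟩ := Submodule.Quotient.mk_surjective _ w
  simp only [tripleTJo_mk, ← Submodule.Quotient.mk_add]
  refine congrArg _ (Subtype.ext ?_)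
  simp only [Submodule.coe_add]
  generalize ⁅(a : Matrix (Fin 3) (Fin 3) k), (b : Matrix (Fin 3) (Fin 3) k)⁆ = c
  simp only [Ring.lie_def]
  noncomm_ring

lemma traceFormTJo_triple_skew (a b u v : TJo k) :
    traceFormTJo k (tripleTJo k a b u) v + traceFormTJo k u (tripleTJo k a b v) = 0 := by
  obtain ⟨a, rfl⟩ := Submodule.Quotient.mk_surjective _ a
  obtain ⟨b, rfl⟩ := Submodule.Quotient.mk_surjective _ b
  obtain ⟨u, rfl⟩ := Submodule.Quotient.mk_surjective _ u
  obtain ⟨v, rfl⟩ := Submodule.Quotient.mk_surjective _ v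
  simp only [tripleTJo_mk, traceFormTJo_mk]
  generalize ⁅(a : Matrix (Fin 3) (Fin 3) k), (b : Matrix (Fin 3) (Fin 3) k)⁆ = c
  simp only [Ring.lie_def, sub_mul, mul_sub, Matrix.trace_sub, ← mul_assoc]
  rw [Matrix.trace_mul_cycle (u : Matrix (Fin 3) (Fin 3) k) v c]
  ring

lemma exists_traceFormTJo_ne_zero_and_isotropic :
    ∃ e f : TJo k, traceFormTJo k e f = 1 ∧ traceFormTJo k f f = 0 :=
  ⟨Submodule.Quotient.mk ⟨Matrix.single 0 1 1, (mem_J0_iff k _).2 (by simp)⟩,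
    Submodule.Quotient.mk ⟨Matrix.single 1 0 1, (mem_J0_iff k _).2 (by simp)⟩,
    by simp [traceFormTJo_mk], by simp [traceFormTJo_mk]⟩

lemma ideal_TJo_eq_bot_or_top (I : Submodule k (TJo k))
    (hI : ∀ x ∈ I, ∀ y z : TJo k, tripleTJo k x y z ∈ I) : I = ⊥ ∨ I = ⊤ := by
  refine or_iff_not_imp_left.2 fun hbot => ?_
  obtain ⟨u, hu, hu0⟩ := I.ne_bot_iff.1 hbot
  have key : ∀ w, traceFormTJo k u w ≠ 0 → w ∈ I := fun w hw => by
    refine (I.smul_mem_iff hw).1 ?_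
    have h := I.add_mem (hI u hu w w) (I.smul_mem (traceFormTJo k w w) hu)
    rwa [tripleTJo_apply_right, sub_add_cancel] at h
  obtain ⟨v, hv⟩ : ∃ v, traceFormTJo k u v ≠ 0 := by
    by_contra! h
    exact hu0 (traceFormTJo_nondegenerate k u h)
  refine eq_top_iff.2 fun w _ => ?_
  by_cases hw : traceFormTJo k u w = 0
  · have h : w + v ∈ I := key _ (by rwa [map_add, hw, zero_add])
    exact (I.add_mem_iff_left (key v hv)).1 h
  · exact key w hw

end TracelessQuotient

/-- For `J = Mat₃(k)` over a field `k` of characteristic 3, the trace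
form and the triple product `[x̂ŷẑ] = class of [L_x,L_y](z)` are well defined on
`T_J^o = J₀/k1` (i.e. they descend to the quotient as (bi/tri)linear maps), the form is
symmetric and nondegenerate, and `T_J^o` is a simple orthogonal triple system. -/
theorem stmt_16 (k : Type*) [Field k] [CharP k 3] :
    ∃ (B : TJo k →ₗ[k] TJo k →ₗ[k] k)
      (P : TJo k →ₗ[k] TJo k →ₗ[k] TJo k →ₗ[k] TJo k),
      -- B is induced by the trace form:
      (∀ x y : J0 k,
        B (Submodule.Quotient.mk x) (Submodule.Quotient.mk y)
          = Matrix.trace (jm k (x : Matrix (Fin 3) (Fin 3) k) (y : Matrix (Fin 3) (Fin 3) k))) ∧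
      -- P is induced by (x,y,z) ↦ x∘(y∘z) − y∘(x∘z), which has trace zero:
      (∀ x y z : J0 k,
        P (Submodule.Quotient.mk x) (Submodule.Quotient.mk y) (Submodule.Quotient.mk z)
          = Submodule.Quotient.mk
              (⟨jm k (x : Matrix (Fin 3) (Fin 3) k) (jm k y z)
                  - jm k (y : Matrix (Fin 3) (Fin 3) k) (jm k x z),
                brkt_mem k x y z⟩ : J0 k)) ∧
      -- the form is symmetric and nondegenerate:
      (∀ u v, B u v = B v u) ∧
      (∀ u, (∀ v, B u v = 0) → u = 0) ∧
      -- (T_J^o, B, P) is an orthogonal triple system: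
      B ≠ 0 ∧
      (∀ u w, P u u w = 0) ∧
      (∀ u w, P u w w = B u w • w - B w w • u) ∧
      (∀ a b u v w, P a b (P u v w)
        = P (P a b u) v w + P u (P a b v) w + P u v (P a b w)) ∧
      (∀ a b u v, B (P a b u) v + B u (P a b v) = 0) ∧
      -- which is simple:
      (∃ u v w, P u v w ≠ 0) ∧
      (∀ I : Submodule k (TJo k),
        (∀ x ∈ I, ∀ y z : TJo k, P x y z ∈ I ∧ P y x z ∈ I ∧ P y z x ∈ I) →
        I = ⊥ ∨ I = ⊤) := by
  obtain ⟨e, f, hef, hff⟩ := exists_traceFormTJo_ne_zero_and_isotropic k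
  refine ⟨traceFormTJo k, tripleTJo k, fun x y => by rw [traceFormTJo_mk, trace_jm],
    fun x y z => ?_, traceFormTJo_comm k, traceFormTJo_nondegenerate k, ?_, tripleTJo_self k,
    tripleTJo_apply_right k, tripleTJo_derivation k, traceFormTJo_triple_skew k,
    ⟨e, f, f, ?_⟩, fun I hI => ideal_TJo_eq_bot_or_top k I fun x hx y z => (hI x hx y z).1⟩
  · rw [tripleTJo_mk]
    exact congrArg _ (Subtype.ext (jm_jm_sub_jm_jm k x y z).symm)
  · intro h
    simp [h] at hef
  · rw [tripleTJo_apply_right, hef, hff, one_smul, zero_smul, sub_zero]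
    rintro rfl
    simp at hef
end
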